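/- arXiv:2302.00959 — 3 statements merged into one kernel-verified Lean document; each statement's English description precedes it below -/
import Mathlib

section
/- (Desnanot–Jacobi / Dodgson condensation.) Let R be a commutative ring, let n ≥ 2, and let A be an n×n matrix over R. Let 1 ≤ i1 < i2 ≤ n be row indices and 1 ≤ j1 < j2 ≤ n be column indices. Denote by A_{(r)|(c)} the matrix obtained from A by deleting the rows with indices in the list (r) and the columns with indices in the list (c). Then det A · det A_{(i1,i2)|(j1,j2)} = det A_{(i1)|(j1)} · det A_{(i2)|(j2)} − det A_{(i1)|(j2)} · det A_{(i2)|(j1)}. -/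
lemma dodgson_aux_det_one {R : Type*} [CommRing R] {m : Type*} [Fintype m] [DecidableEq m]
    (u v : m → R) (a b : m) (hab : a ≠ b) :
    (((1 : Matrix m m R).updateCol a u).updateCol b v).det = u a * v b - u b * v a := by
  have h : (((1 : Matrix m m R).updateCol a u).updateCol b v) =
      1 + (Matrix.of fun i (k : Fin 2) => (![u i - (1 : Matrix m m R) i a,
        v i - (1 : Matrix m m R) i b] : Fin 2 → R) k) *
        (Matrix.of fun (k : Fin 2) j => (![(1 : Matrix m m R) a j, (1 : Matrix m m R) b j] : Fin 2 → R) k) := by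
    ext i j
    simp only [Matrix.add_apply, Matrix.mul_apply, Fin.sum_univ_two, Matrix.of_apply,
      Matrix.updateCol_apply]
    by_cases h1 : j = b
    · subst h1; simp [hab]
    · by_cases h2 : j = a
      · subst h2; simp [hab, hab.symm]
      · simp [h1, h2, Matrix.one_apply, Ne.symm h1, Ne.symm h2]
  rw [h, Matrix.det_one_add_mul_comm, Matrix.det_fin_two]
  simp [Matrix.mul_apply, Matrix.one_apply, hab, hab.symm]
  ring

lemma dodgson_aux_dom {R : Type*} [CommRing R] {m : Type*} [Fintype m] [DecidableEq m]
    (A : Matrix m m R) (a b i j : m) (hab : a ≠ b) :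
    A.det * (A.det * ((A.updateCol a (Pi.single i 1)).updateCol b (Pi.single j 1)).det) =
      A.det * (A.adjugate a i * A.adjugate b j - A.adjugate b i * A.adjugate a j) := by
  have key : A * (((1 : Matrix m m R).updateCol a (fun k => A.adjugate k i)).updateCol b
      (fun k => A.adjugate k j)) =
      (A.updateCol a (A.det • Pi.single i 1)).updateCol b (A.det • Pi.single j 1) := by
    have hA := Matrix.mul_adjugate A
    ext x y
    have h1 := congrFun (congrFun hA x) i
    have h2 := congrFun (congrFun hA x) j
    simp only [Matrix.mul_apply, Matrix.smul_apply, Matrix.one_apply] at h1 h2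
    simp only [Matrix.mul_apply, Matrix.updateCol_apply, Pi.smul_apply, Pi.single_apply]
    by_cases hb : y = b
    · simp [hb, h2]
    · by_cases ha : y = a
      · simp [ha, hab, h1]
      · simp [ha, hb, Matrix.one_apply]
  have h := congrArg Matrix.det key
  rw [Matrix.det_mul, dodgson_aux_det_one _ _ _ _ hab, Matrix.det_updateCol_smul,
    Matrix.updateCol_comm _ hab, Matrix.det_updateCol_smul, Matrix.updateCol_comm _ hab.symm] at h
  rw [h]

lemma dodgson_aux {R : Type*} [CommRing R] {m : Type*} [Fintype m] [DecidableEq m]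
    (A : Matrix m m R) (a b i j : m) (hab : a ≠ b) :
    A.det * ((A.updateCol a (Pi.single i 1)).updateCol b (Pi.single j 1)).det =
      A.adjugate a i * A.adjugate b j - A.adjugate b i * A.adjugate a j := by
  let X := Matrix.mvPolynomialX m m ℤ
  have hX := mul_left_cancel₀ (Matrix.det_mvPolynomialX_ne_zero m ℤ)
    (dodgson_aux_dom X a b i j hab)
  let f := (MvPolynomial.aeval (R := ℤ) fun p : m × m => A p.1 p.2).toRingHom
  have hf : f.mapMatrix X = A := by
    ext x y; simp [f, X, Matrix.mvPolynomialX]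
  have h := congrArg f hX
  have hadj : ∀ x y, f (X.adjugate x y) = A.adjugate x y := by
    intro x y
    rw [← hf, ← RingHom.map_adjugate]; rfl
  rw [map_mul, map_sub, map_mul, map_mul, hadj, hadj, hadj, hadj, RingHom.map_det,
    RingHom.map_det, hf] at h
  rw [← h]
  congr 2
  ext x y
  have := congrFun (congrFun hf x) y
  simp only [RingHom.mapMatrix_apply, Matrix.map_apply] at this
  simp only [RingHom.mapMatrix_apply, Matrix.map_apply, Matrix.updateCol_apply, Pi.single_apply]
  split_ifs <;> simp [this]

lemma dodgson_aux_cof {R : Type*} [CommRing R] {n : ℕ}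
    (A : Matrix (Fin (n + 1)) (Fin (n + 1)) R) (i j : Fin (n + 1)) :
    (A.updateCol j (Pi.single i 1)).det =
      (-1) ^ (i + j : ℕ) * (A.submatrix i.succAbove j.succAbove).det := by
  rw [← Matrix.adjugate_fin_succ_eq_det_submatrix, ← Matrix.cramer_apply,
    Matrix.cramer_eq_adjugate_mulVec]
  simp

/-- Desnanot–Jacobi / Dodgson condensation: for an `n×n` matrix (`n ≥ 2`) over a
commutative ring, with row indices `i₁ < i₂` and column indices `j₁ < j₂`,
`det A · det A_{(i₁,i₂)|(j₁,j₂)} = det A_{(i₁)|(j₁)} · det A_{(i₂)|(j₂)} −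
det A_{(i₁)|(j₂)} · det A_{(i₂)|(j₁)}`, where deleted rows/columns are realized
via `Fin.succAbove`. -/
theorem dodgson_condensation {R : Type*} [CommRing R] (n : ℕ)
    (A : Matrix (Fin (n + 2)) (Fin (n + 2)) R)
    (i₁ i₂ j₁ j₂ : Fin (n + 2)) (hi : i₁ < i₂) (hj : j₁ < j₂) :
    A.det *
      (A.submatrix
        (i₂.succAbove ∘
          (i₁.castLT (lt_of_lt_of_le (Fin.lt_def.mp hi) (Nat.lt_succ_iff.mp i₂.isLt))).succAbove)
        (j₂.succAbove ∘
          (j₁.castLT (lt_of_lt_of_le (Fin.lt_def.mp hj) (Nat.lt_succ_iff.mp j₂.isLt))).succAbove)).det =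
      (A.submatrix i₁.succAbove j₁.succAbove).det * (A.submatrix i₂.succAbove j₂.succAbove).det -
      (A.submatrix i₁.succAbove j₂.succAbove).det * (A.submatrix i₂.succAbove j₁.succAbove).det := by
  set i' := i₁.castLT (lt_of_lt_of_le (Fin.lt_def.mp hi) (Nat.lt_succ_iff.mp i₂.isLt)) with hi'
  set j' := j₁.castLT (lt_of_lt_of_le (Fin.lt_def.mp hj) (Nat.lt_succ_iff.mp j₂.isLt)) with hj'
  have ei : i₂.succAbove i' = i₁ := by
    rw [Fin.succAbove_of_castSucc_lt]
    · rfl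
    · exact hi
  have ej : j₂.succAbove j' = j₁ := by
    rw [Fin.succAbove_of_castSucc_lt]
    · rfl
    · exact hj
  have h := dodgson_aux A j₁ j₂ i₁ i₂ hj.ne
  have hs : (A.updateCol j₁ (Pi.single i₁ 1)).submatrix i₂.succAbove j₂.succAbove =
      (A.submatrix i₂.succAbove j₂.succAbove).updateCol j' (Pi.single i' 1) := by
    ext x y
    simp only [Matrix.submatrix_apply, Matrix.updateCol_apply, Pi.single_apply, ← ei, ← ej,
      Fin.succAbove_right_inj]
  rw [dodgson_aux_cof, hs, dodgson_aux_cof, Matrix.submatrix_submatrix] at h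
  simp only [Matrix.adjugate_fin_succ_eq_det_submatrix] at h
  have vi : (i' : ℕ) = i₁ := rfl
  have vj : (j' : ℕ) = j₁ := rfl
  rw [vi, vj] at h
  have hu : ((-1 : R) ^ (i₂ + j₂ + (i₁ + j₁) : ℕ)) * (-1) ^ (i₂ + j₂ + (i₁ + j₁) : ℕ) = 1 := by
    rw [← mul_pow]; simp
  generalize hD : (A.submatrix (i₂.succAbove ∘ i'.succAbove) (j₂.succAbove ∘ j'.succAbove)).det = D at h ⊢
  simp only [pow_add] at h hu
  linear_combination ((-1 : R) ^ (i₂ : ℕ) * (-1) ^ (j₂ : ℕ) * ((-1) ^ (i₁ : ℕ) * (-1) ^ (j₁ : ℕ))) * h -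
    (A.det * D - (A.submatrix i₁.succAbove j₁.succAbove).det * (A.submatrix i₂.succAbove j₂.succAbove).det +
      (A.submatrix i₁.succAbove j₂.succAbove).det * (A.submatrix i₂.succAbove j₁.succAbove).det) * hu
end

section
/- Let a, b, c, d be positive integers with c ≥ 1 and 2d < b + 2. Then E(a,b,c,d,1−d) = M(a,b,c) · ( 1 − ((c)_a / ((a−1)! · (b+c−2d+2)_{a+2d−2})) · ∑_{k=0}^{a−1} (−1)^{a+k−1} · C(a−1, k) · (b−2d+k+3−a)_{a+2d−2} / (a+c−k−1) ), where (x)_n denotes the Pochhammer symbol (rising factorial) and the Pochhammer symbols are evaluated over the rationals. -/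
open Finset

noncomputable section

/-- Binomial coefficient with integer arguments, equal to `0` whenever `k < 0` or `k > n`. -/
def ibinom (n k : ℤ) : ℚ :=
  if 0 ≤ k ∧ k ≤ n then (n.toNat.choose k.toNat : ℚ) else 0

/-- The Pochhammer symbol (rising factorial) `x (x+1) ⋯ (x+n-1)`. -/
def poch (x : ℚ) (n : ℕ) : ℚ := (ascPochhammer ℚ n).eval x

/-- MacMahon's product `M(a,b,c)`. -/
def macmahon (a b c : ℕ) : ℚ :=
  ∏ i ∈ Finset.range a,
    ((Nat.factorial i : ℚ) * (Nat.factorial (b + c + i) : ℚ)) /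
      ((Nat.factorial (b + i) : ℚ) * (Nat.factorial (c + i) : ℚ))

/-- The matrix `Q(a,b,c,d,p)` (with `1`-based indices `i, j ∈ {1, …, a+d}`):
rows/columns with index `≤ a` are lateral, the rest are intrusive. -/
def Qmat (a b c d : ℕ) (p : ℤ) : Matrix (Fin (a + d)) (Fin (a + d)) ℚ :=
  Matrix.of fun i j =>
    if (i : ℕ) < a then
      if (j : ℕ) < a then
        ibinom ((b : ℤ) + c) ((c : ℤ) - (((i : ℕ) : ℤ) + 1) + (((j : ℕ) : ℤ) + 1))
      else
        ibinom (2 * (((j : ℕ) : ℤ) - a + 1) - 1)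
          ((((j : ℕ) : ℤ) - a + 1) - (((i : ℕ) : ℤ) + 1) + p)
    else
      if (j : ℕ) < a then
        ibinom ((b : ℤ) + c - 2 * (((i : ℕ) : ℤ) - a + 1) + 1)
          ((c : ℤ) - (((i : ℕ) : ℤ) - a + 1) + (((j : ℕ) : ℤ) + 1) - p)
      else
        ibinom (2 * (((j : ℕ) : ℤ) - ((i : ℕ) : ℤ))) (((j : ℕ) : ℤ) - ((i : ℕ) : ℤ))

/-- `E(a,b,c,d,p) = det Q(a,b,c,d,p)`, the signed count of lozenge tilings of the
`(a,b,c)`-hexagon with an even intrusion of length `d` at position `p`. -/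
def E (a b c d : ℕ) (p : ℤ) : ℚ := (Qmat a b c d p).det

open Polynomial in
lemma sum_poly_zero (P : ℚ[X]) (n : ℕ) (hP : P.natDegree < n) :
    ∑ k ∈ Finset.range (n + 1), (-1 : ℚ) ^ k * (n.choose k : ℚ) * P.eval (k : ℚ) = 0 := by
  have h := congrFun (Polynomial.fwdDiff_iter_eq_zero_of_degree_lt hP) 0
  rw [fwdDiff_iter_eq_sum_shift] at h
  have h2 : ∑ k ∈ Finset.range (n + 1), (-1 : ℚ) ^ k * (n.choose k : ℚ) * P.eval (k : ℚ) =
      (-1 : ℚ) ^ n * ∑ k ∈ Finset.range (n + 1),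
        ((-1 : ℤ) ^ (n - k) * n.choose k) • P.eval (0 + k • (1 : ℚ)) := by
    rw [Finset.mul_sum]
    refine Finset.sum_congr rfl fun k hk => ?_
    have hk' : k ≤ n := by simpa [Nat.lt_succ_iff] using hk
    obtain ⟨l, rfl⟩ := Nat.exists_eq_add_of_le hk'
    have : ((-1 : ℚ) ^ l) * (-1) ^ l = 1 := by rw [← mul_pow]; simp
    simp only [zsmul_eq_mul, nsmul_eq_mul, mul_one, zero_add, Nat.add_sub_cancel_left, pow_add]
    push_cast
    linear_combination (-(-1 : ℚ) ^ k * ((k + l).choose k : ℚ) * P.eval (k : ℚ)) * this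
  rw [h2, h]; simp

lemma sum_inv (n : ℕ) : ∀ q : ℕ,
    ∑ k ∈ Finset.range (n + 1), (-1 : ℚ) ^ k * (n.choose k : ℚ) * (1 / ((q : ℚ) + 1 + k)) =
      (n.factorial : ℚ) * q.factorial / (q + n + 1).factorial := by
  induction n with
  | zero => 
    intro q
    have : (q.factorial : ℚ) ≠ 0 := by positivity
    simp [Nat.factorial_succ]
    field_simp
  | succ n ih =>
    intro q
    have key : ∑ k ∈ Finset.range (n + 1 + 1),
        (-1 : ℚ) ^ k * ((n + 1).choose k : ℚ) * (1 / ((q : ℚ) + 1 + k)) =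
        (∑ k ∈ Finset.range (n + 1), (-1 : ℚ) ^ k * (n.choose k : ℚ) * (1 / ((q : ℚ) + 1 + k))) -
        ∑ k ∈ Finset.range (n + 1),
          (-1 : ℚ) ^ k * (n.choose k : ℚ) * (1 / (((q + 1 : ℕ) : ℚ) + 1 + k)) := by
      have e1 : ∑ k ∈ Finset.range (n + 1),
          (-1 : ℚ) ^ k * (n.choose k : ℚ) * (1 / ((q : ℚ) + 1 + k)) =
          ∑ k ∈ Finset.range (n + 1 + 1),
          (-1 : ℚ) ^ k * (n.choose k : ℚ) * (1 / ((q : ℚ) + 1 + k)) := by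
        rw [Finset.sum_range_succ _ (n + 1)]; simp
      rw [e1, Finset.sum_range_succ', Finset.sum_range_succ' _ (n + 1)]
      simp only [Nat.choose_succ_succ]
      rw [← sub_eq_zero]
      simp only [Nat.choose_zero_right]
      rw [show ∀ x y z w : ℚ, x + y - (z + y - w) = x - z + w by intros; ring]
      rw [← Finset.sum_sub_distrib, ← Finset.sum_add_distrib]
      refine Finset.sum_eq_zero fun k _ => ?_
      push_cast
      rw [show (q : ℚ) + 1 + 1 + k = q + 1 + (k + 1) by ring, pow_succ]
      ring
    rw [key, ih, ih]
    rw [show q + 1 + n + 1 = (q + n + 1) + 1 by ring, show q + (n + 1) + 1 = (q + n + 1) + 1 by ring]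
    rw [Nat.factorial_succ (q + n + 1), Nat.factorial_succ q, Nat.factorial_succ n]
    have : ((q + n + 1).factorial : ℚ) ≠ 0 := by positivity
    have : (q : ℚ) + n + 1 + 1 ≠ 0 := by positivity
    push_cast
    field_simp
    ring

lemma ibinom_fact (u v : ℕ) (x y : ℤ) (hx : x = u + v) (hy : y = u) :
    ibinom x y * ((u.factorial : ℚ) * v.factorial) = (u + v).factorial := by
  subst hx hy
  unfold ibinom
  rw [if_pos (by omega)]
  have h1 : ((u : ℤ) + v).toNat = u + v := by omega
  have h2 : (u : ℤ).toNat = u := by omega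
  rw [h1, h2]
  have := Nat.add_choose_mul_factorial_mul_factorial u v
  rw [← Nat.choose_symm_add] at this
  rw [← this]; push_cast
  ring

lemma ibinom_neg (x y : ℤ) (h : y < 0 ∨ x < y) : ibinom x y = 0 := by
  unfold ibinom
  rw [if_neg (by omega)]

lemma ib_succ (b q n s m : ℕ) (hs : s + 1 ≤ n) (hm : m ≤ n) (x y : ℤ)
    (hx : x = (b : ℤ) + q + 1) (hy : y = (q : ℤ) + m - s) :
    ibinom x y * ((b + n - m).factorial * (q + m).factorial) =
    (b + q + 1).factorial *
      (((b + n - m).descFactorial (n - (s + 1)) : ℚ) * (q + m).descFactorial s) := by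
  rcases lt_or_ge (q + m) s with h1 | h1
  · rw [ibinom_neg _ _ (by omega), Nat.descFactorial_of_lt h1]; simp
  rcases lt_or_ge (b + (s + 1)) m with h2 | h2
  · rw [ibinom_neg _ _ (by omega),
      (Nat.descFactorial_of_lt (by omega) : (b + n - m).descFactorial (n - (s + 1)) = 0)]; simp
  have e := ibinom_fact (q + m - s) (b + (s + 1) - m) x y (by omega) (by omega)
  have e1 := Nat.factorial_mul_descFactorial h1
  have e2 := Nat.factorial_mul_descFactorial
    (show n - (s + 1) ≤ b + n - m by omega)
  rw [show b + n - m - (n - (s + 1)) = b + (s + 1) - m by omega] at e2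
  rw [show q + m - s + (b + (s + 1) - m) = b + q + 1 by omega] at e
  rw [← e1, ← e2, ← e]
  push_cast
  ring

lemma ib_zero (b q n m : ℕ) (hm : m ≤ n) (x y : ℤ)
    (hx : x = (b : ℤ) + q + 1) (hy : y = (q : ℤ) + 1 + m) :
    ibinom x y * ((b + n - m).factorial * (q + m).factorial) =
    (b + q + 1).factorial *
      (((b + n - m).descFactorial n : ℚ) * (1 / ((q : ℚ) + 1 + m))) := by
  rcases lt_or_ge b m with h2 | h2
  · rw [ibinom_neg _ _ (by omega),
      (Nat.descFactorial_of_lt (by omega) : (b + n - m).descFactorial n = 0)]; simp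
  have e := ibinom_fact (q + m + 1) (b - m) x y (by omega) (by omega)
  have e2 := Nat.factorial_mul_descFactorial
    (show n ≤ b + n - m by omega)
  rw [show b + n - m - n = b - m by omega] at e2
  rw [show q + m + 1 + (b - m) = b + q + 1 by omega, Nat.factorial_succ] at e
  rw [← e2, ← e]
  have : (q : ℚ) + 1 + m ≠ 0 := by positivity
  push_cast
  field_simp
  ring

/-- the (unnormalised) first column of the inverse -/
def yv (b q n m : ℕ) : ℚ :=
  (-1) ^ m * (n.choose m : ℚ) * ((b + n - m).factorial * (q + m).factorial)

/-- normalisation -/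
def kap (b q n : ℕ) : ℚ :=
  (b + q + 1 + n).factorial * ((n.factorial : ℚ) * q.factorial / (q + n + 1).factorial)

open Polynomial in
lemma natDegree_desc_comp_sub (k : ℕ) (r : ℚ) :
    ((descPochhammer ℚ k).comp (C r - X)).natDegree ≤ k := by
  refine natDegree_comp_le.trans ?_
  rw [descPochhammer_natDegree]
  have : (C r - X : ℚ[X]).natDegree ≤ 1 := by compute_degree
  nlinarith

open Polynomial in
lemma natDegree_desc_comp_add (k : ℕ) (r : ℚ) :
    ((descPochhammer ℚ k).comp (C r + X)).natDegree ≤ k := by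
  refine natDegree_comp_le.trans ?_
  rw [descPochhammer_natDegree]
  have : (C r + X : ℚ[X]).natDegree ≤ 1 := by compute_degree
  nlinarith

open Polynomial in
lemma sum_row_succ (b q n s : ℕ) (hs : s + 1 ≤ n) :
    ∑ m ∈ Finset.range (n + 1), ibinom ((b : ℤ) + q + 1) ((q : ℤ) + m - s) * yv b q n m = 0 := by
  have hdeg : ((descPochhammer ℚ (n - (s + 1))).comp (C ((b : ℚ) + n) - X) *
      (descPochhammer ℚ s).comp (C (q : ℚ) + X)).natDegree < n := by
    refine lt_of_le_of_lt natDegree_mul_le ?_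
    have h1 := natDegree_desc_comp_sub (n - (s + 1)) ((b : ℚ) + n)
    have h2 := natDegree_desc_comp_add s (q : ℚ)
    omega
  have h := sum_poly_zero _ n hdeg
  have h' := congrArg (fun z => ((b + q + 1).factorial : ℚ) * z) h
  simp only [mul_zero] at h'
  rw [← h', Finset.mul_sum]
  refine Finset.sum_congr rfl fun m hm => ?_
  have hm' : m ≤ n := by simpa [Nat.lt_succ_iff] using hm
  have e := ib_succ b q n s m hs hm' _ _ rfl rfl
  have e1 : ((b : ℚ) + n - m) = ((b + n - m : ℕ) : ℚ) := by
    rw [Nat.cast_sub (by omega)]; push_cast; ring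
  have e2 : ((q : ℚ) + m) = ((q + m : ℕ) : ℚ) := by push_cast; ring
  simp only [eval_mul, eval_comp, eval_sub, eval_add, eval_C, eval_X]
  rw [e1, e2, descPochhammer_eval_eq_descFactorial, descPochhammer_eval_eq_descFactorial]
  unfold yv
  linear_combination ((-1) ^ m * (n.choose m : ℚ)) * e

open Polynomial in
lemma sum_row_zero (b q n : ℕ) :
    ∑ m ∈ Finset.range (n + 1), ibinom ((b : ℤ) + q + 1) ((q : ℤ) + 1 + m) * yv b q n m =
      kap b q n := by
  set P : ℚ[X] := (descPochhammer ℚ n).comp (C ((b : ℚ) + n) - X) with hPdef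
  have hP : P.natDegree ≤ n := natDegree_desc_comp_sub n _
  set r : ℚ := -((q : ℚ) + 1) with hr
  have hdiv := modByMonic_add_div P (X - C r)
  rw [modByMonic_X_sub_C_eq_C_eval] at hdiv
  set R := P /ₘ (X - C r) with hR
  have hRdeg : R.natDegree = P.natDegree - 1 := by
    rw [hR, natDegree_divByMonic _ (monic_X_sub_C r), natDegree_X_sub_C]
  have hR0 : ∑ k ∈ Finset.range (n + 1), (-1 : ℚ) ^ k * (n.choose k : ℚ) * R.eval (k : ℚ) = 0 := by
    rcases Nat.eq_zero_or_pos n with rfl | hn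
    · have : R = 0 := by
        rw [hR, hPdef]
        rw [divByMonic_eq_zero_iff (monic_X_sub_C r)]
        simp
      simp [this]
    · exact sum_poly_zero R n (by omega)
  have hPr : P.eval r * ((b + q + 1).factorial : ℚ) = ((b + q + 1 + n).factorial : ℚ) := by
    have e : (b : ℚ) + n - r = ((b + q + 1 + n : ℕ) : ℚ) := by rw [hr]; push_cast; ring
    rw [hPdef]
    simp only [eval_comp, eval_sub, eval_C, eval_X]
    rw [e, descPochhammer_eval_eq_descFactorial]
    have := Nat.factorial_mul_descFactorial (show n ≤ b + q + 1 + n by omega)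
    rw [Nat.add_sub_cancel] at this
    rw [← this]; push_cast; ring
  have hS := sum_inv n q
  unfold kap
  rw [← hS, ← hPr]
  have : ∀ m ∈ Finset.range (n + 1),
      ibinom ((b : ℤ) + q + 1) ((q : ℤ) + 1 + m) * yv b q n m =
      P.eval r * ((b + q + 1).factorial : ℚ) *
        ((-1 : ℚ) ^ m * (n.choose m : ℚ) * (1 / ((q : ℚ) + 1 + m))) +
      ((b + q + 1).factorial : ℚ) * ((-1 : ℚ) ^ m * (n.choose m : ℚ) * R.eval (m : ℚ)) := by
    intro m hm
    have hm' : m ≤ n := by simpa [Nat.lt_succ_iff] using hm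
    have e := ib_zero b q n m hm' _ _ rfl rfl
    have e1 : ((b : ℚ) + n - m) = ((b + n - m : ℕ) : ℚ) := by
      rw [Nat.cast_sub (by omega)]; push_cast; ring
    have e3 : P.eval (m : ℚ) = ((b + n - m).descFactorial n : ℚ) := by
      rw [hPdef]
      simp only [eval_comp, eval_sub, eval_C, eval_X]
      rw [e1, descPochhammer_eval_eq_descFactorial]
    have e4 : P.eval (m : ℚ) = P.eval r + ((q : ℚ) + 1 + m) * R.eval (m : ℚ) := by
      conv_lhs => rw [← hdiv]
      simp only [eval_add, eval_mul, eval_sub, eval_C, eval_X]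
      rw [hr]; ring
    have hne : (q : ℚ) + 1 + m ≠ 0 := by positivity
    rw [← e3, e4] at e
    unfold yv
    rw [show ∀ x y z : ℚ, x * (y * z) = y * (x * z) by intros; ring, e]
    field_simp
  rw [Finset.sum_congr rfl this, Finset.sum_add_distrib, ← Finset.mul_sum, ← Finset.mul_sum, hR0]
  ring

/-- the Toeplitz matrix of binomials -/
def Amat (b q n : ℕ) : Matrix (Fin n) (Fin n) ℚ :=
  Matrix.of fun i j => ibinom ((b : ℤ) + q + 1) ((q : ℤ) + 1 + (j : ℕ) - (i : ℕ))

/-- Cramer-type evaluation: replace row 0 -/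
lemma det_row (b q n : ℕ) (r : Fin (n + 1) → ℚ) :
    ((Amat b q (n + 1)).updateRow 0 r).det * (((b + n).factorial : ℚ) * q.factorial) =
      (∑ j, r j * yv b q n j) * (Amat b q n).det := by
  set A' := (Amat b q (n + 1)).updateRow 0 r with hA'
  set y : Fin (n + 1) → ℚ := fun j => yv b q n j with hy
  have h1 : A'.mulVec y = Pi.single 0 (∑ j, r j * yv b q n j) := by
    funext i
    refine Fin.cases ?_ (fun i => ?_) i
    · simp [hA', Matrix.mulVec, dotProduct, hy]
    · have := sum_row_succ b q n i (by omega)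
      rw [← Fin.sum_univ_eq_sum_range
        (fun m => ibinom ((b : ℤ) + q + 1) ((q : ℤ) + m - i) * yv b q n m)] at this
      simp only [Pi.single_apply, Fin.succ_ne_zero, if_false]
      rw [← this]
      simp only [hA', Matrix.mulVec, dotProduct, hy]
      refine Finset.sum_congr rfl fun j _ => ?_
      rw [Matrix.updateRow_ne (Fin.succ_ne_zero i)]
      simp only [Amat, Matrix.of_apply, Fin.val_succ]
      congr 2
      push_cast; ring
  have h2 := congrArg (fun v => (A'.adjugate.mulVec v) 0) h1
  simp only [Matrix.mulVec_mulVec, Matrix.adjugate_mul, Matrix.smul_mulVec, Matrix.one_mulVec,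
    Matrix.mulVec_single, Pi.smul_apply, smul_eq_mul] at h2
  have h3 : y 0 = ((b + n).factorial : ℚ) * q.factorial := by simp [hy, yv]
  rw [h3] at h2
  rw [h2]
  simp only [Matrix.col_apply, Matrix.adjugate_fin_succ_eq_det_submatrix]
  have h4 : A'.submatrix (Fin.succAbove 0) (Fin.succAbove 0) = Amat b q n := by
    ext i j
    simp only [Matrix.submatrix_apply, Fin.succAbove_zero, hA']
    rw [Matrix.updateRow_ne (Fin.succ_ne_zero i)]
    simp only [Amat, Matrix.of_apply, Fin.val_succ]
    congr 1
    push_cast; ring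
  rw [h4]
  simp
  try ring

lemma det_Amat (b q n : ℕ) : (Amat b q n).det = macmahon n b (q + 1) := by
  induction n with
  | zero => simp [macmahon]
  | succ n ih =>
    have h := det_row b q n ((Amat b q (n + 1)) 0)
    rw [Matrix.updateRow_eq_self] at h
    have h0 := sum_row_zero b q n
    rw [← Fin.sum_univ_eq_sum_range
        (fun m => ibinom ((b : ℤ) + q + 1) ((q : ℤ) + 1 + m) * yv b q n m)] at h0
    have : ∑ j : Fin (n + 1), (Amat b q (n + 1)) 0 j * yv b q n j = kap b q n := by
      rw [← h0]
      refine Finset.sum_congr rfl fun j _ => ?_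
      simp [Amat]
    rw [this, ih] at h
    unfold macmahon at h ⊢
    rw [Finset.prod_range_succ]
    set PP := ∏ i ∈ Finset.range n, ((Nat.factorial i : ℚ) * (Nat.factorial (b + (q + 1) + i) : ℚ)) /
      ((Nat.factorial (b + i) : ℚ) * (Nat.factorial (q + 1 + i) : ℚ))
    have n1 : ((b + n).factorial : ℚ) ≠ 0 := by positivity
    have n2 : (q.factorial : ℚ) ≠ 0 := by positivity
    have n3 : ((q + 1 + n).factorial : ℚ) ≠ 0 := by positivity
    unfold kap at h
    rw [show q + n + 1 = q + 1 + n by ring] at h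
    rw [← add_assoc b q 1]
    field_simp at h ⊢
    linear_combination h

/-- last lower-left row -/
def Brow (b q e n : ℕ) (j : Fin n) : ℚ :=
  ibinom ((b : ℤ) + q - 2 * e) ((q : ℤ) + 1 + (j : ℕ))

/-- lower-left block -/
def Bblk (b q e n : ℕ) : Matrix (Fin (e + 1)) (Fin n) ℚ :=
  Matrix.of fun i j => ibinom ((b : ℤ) + q - 2 * (i : ℕ)) ((q : ℤ) + 1 + (e : ℤ) - (i : ℕ) + (j : ℕ))

/-- lower-right block -/
def Ublk (e : ℕ) : Matrix (Fin (e + 1)) (Fin (e + 1)) ℚ :=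
  Matrix.of fun i j => ibinom (2 * (((j : ℕ) : ℤ) - (i : ℕ))) (((j : ℕ) : ℤ) - (i : ℕ))

/-- upper-right block -/
def Tblk (n e : ℕ) : Matrix (Fin (n + 1)) (Fin (e + 1)) ℚ :=
  Matrix.of fun i j => if i = 0 ∧ j = Fin.last e then 1 else 0

lemma Ublk_diag (e : ℕ) (i : Fin (e + 1)) : Ublk e i i = 1 := by
  simp [Ublk, ibinom]

lemma Ublk_lower (e : ℕ) (i j : Fin (e + 1)) (h : j < i) : Ublk e i j = 0 := by
  have : (j : ℕ) < i := h
  simp only [Ublk, Matrix.of_apply]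
  exact ibinom_neg _ _ (by omega)

lemma det_Ublk (e : ℕ) : (Ublk e).det = 1 := by
  rw [Matrix.det_of_isUpperTriangular (fun i j h => Ublk_lower e i j h)]
  simp [Ublk_diag]

lemma Tblk_mul (n e k : ℕ) (M : Matrix (Fin (e + 1)) (Fin k) ℚ) (i : Fin (n + 1)) (j : Fin k) :
    (Tblk n e * M) i j = if i = 0 then M (Fin.last e) j else 0 := by
  rw [Matrix.mul_apply]
  by_cases h : i = 0
  · simp [Tblk, h]
  · simp [Tblk, h]

lemma Tblk_mul_U (n e : ℕ) : Tblk n e * Ublk e = Tblk n e := by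
  ext i j
  rw [Tblk_mul]
  by_cases h : i = 0
  · by_cases hj : j = Fin.last e
    · simp [h, hj, Tblk, Ublk_diag]
    · have : j < Fin.last e := lt_of_le_of_ne (Fin.le_last j) hj
      simp [h, hj, Tblk, Ublk_lower _ _ _ this]
  · simp [h, Tblk]

lemma Q_blocks (n b q e : ℕ) :
    (Qmat (n + 1) b (q + 1) (e + 1) (1 - ((e + 1 : ℕ) : ℤ))).submatrix
      finSumFinEquiv finSumFinEquiv =
    Matrix.fromBlocks (Amat b q (n + 1)) (Tblk n e) (Bblk b q e (n + 1)) (Ublk e) := by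
  ext i j
  rcases i with i | i <;> rcases j with j | j
  · simp only [Matrix.submatrix_apply, finSumFinEquiv_apply_left, Matrix.fromBlocks_apply₁₁,
      Qmat, Matrix.of_apply, Fin.val_castAdd, i.2, j.2, if_true, Amat]
    congr 1 <;> (push_cast; ring)
  · simp only [Matrix.submatrix_apply, finSumFinEquiv_apply_left, finSumFinEquiv_apply_right,
      Matrix.fromBlocks_apply₁₂, Qmat, Matrix.of_apply, Fin.val_castAdd, Fin.val_natAdd, i.2,
      if_true, Tblk]
    rw [if_neg (by omega)]
    have hj := j.2
    by_cases h : i = 0 ∧ j = Fin.last e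
    · rw [if_pos h]
      obtain ⟨rfl, rfl⟩ := h
      have e1 : (((n + 1 + (Fin.last e : ℕ) : ℕ) : ℤ) - ((n + 1 : ℕ) : ℤ) + 1 -
          (((0 : Fin (n + 1)) : ℕ) + 1) + (1 - ((e + 1 : ℕ) : ℤ))) = 0 := by
        simp
      rw [e1]
      unfold ibinom
      rw [if_pos (by simp; omega)]
      simp
    · rw [if_neg h]
      apply ibinom_neg
      left
      rw [Fin.ext_iff, Fin.ext_iff] at h
      simp only [Fin.val_zero, Fin.val_last] at h
      push_cast
      omega
  · simp only [Matrix.submatrix_apply, finSumFinEquiv_apply_left, finSumFinEquiv_apply_right,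
      Matrix.fromBlocks_apply₂₁, Qmat, Matrix.of_apply, Fin.val_castAdd, Fin.val_natAdd, j.2,
      if_true, Bblk]
    rw [if_neg (by omega)]
    congr 1 <;> (push_cast; ring)
  · simp only [Matrix.submatrix_apply, finSumFinEquiv_apply_right,
      Matrix.fromBlocks_apply₂₂, Qmat, Matrix.of_apply, Fin.val_natAdd, Ublk]
    rw [if_neg (by omega), if_neg (by omega)]
    congr 1 <;> (push_cast; ring)

lemma E_reduce (n b q e : ℕ) :
    E (n + 1) b (q + 1) (e + 1) (1 - ((e + 1 : ℕ) : ℤ)) =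
      ((Amat b q (n + 1)).updateRow 0
        (fun j => Amat b q (n + 1) 0 j - Brow b q e (n + 1) j)).det := by
  unfold E
  rw [← Matrix.det_submatrix_equiv_self finSumFinEquiv, Q_blocks]
  let _ : Invertible (Ublk e) := Matrix.invertibleOfIsUnitDet _ (by rw [det_Ublk]; exact isUnit_one)
  rw [Matrix.det_fromBlocks₂₂, det_Ublk, one_mul]
  have hT : Tblk n e * ⅟(Ublk e) = Tblk n e := by
    conv_lhs => rw [← Tblk_mul_U n e]
    rw [Matrix.mul_assoc, mul_invOf_self, Matrix.mul_one]
  rw [hT]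
  congr 1
  ext i j
  rw [Matrix.sub_apply, Tblk_mul, Matrix.updateRow_apply]
  by_cases h : i = 0
  · simp only [h, if_true]
    congr 1
    simp only [Bblk, Brow, Matrix.of_apply, Fin.val_last]
    congr 1; ring
  · simp [h]

lemma poch_nat (x k : ℕ) (r : ℚ) (hr : r = (x : ℚ) - k + 1) :
    poch r k = (x.descFactorial k : ℚ) := by
  subst hr
  unfold poch
  rw [← descPochhammer_eval_eq_ascPochhammer, descPochhammer_eval_eq_descFactorial]

lemma brow_term (f e q n m : ℕ) (hm : m ≤ n) :
    ibinom (((2 * e + 1 + f : ℕ) : ℤ) + q - 2 * e) ((q : ℤ) + 1 + m) *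
      (((2 * e + 1 + f) + n - m).factorial * (q + m).factorial) =
    (q + 1 + f).factorial *
      ((((2 * e + 1 + f) + n - m).descFactorial (n + 2 * e + 1) : ℚ) / ((q : ℚ) + 1 + m)) := by
  rcases lt_or_ge f m with h2 | h2
  · rw [ibinom_neg _ _ (by push_cast; omega),
      (Nat.descFactorial_of_lt (by omega) :
        ((2 * e + 1 + f) + n - m).descFactorial (n + 2 * e + 1) = 0)]; simp
  have e0 := ibinom_fact (q + m + 1) (f - m) (((2 * e + 1 + f : ℕ) : ℤ) + q - 2 * e)
    ((q : ℤ) + 1 + m) (by omega) (by omega)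
  have e2 := Nat.factorial_mul_descFactorial
    (show n + 2 * e + 1 ≤ (2 * e + 1 + f) + n - m by omega)
  rw [show (2 * e + 1 + f) + n - m - (n + 2 * e + 1) = f - m by omega] at e2
  rw [show q + m + 1 + (f - m) = q + 1 + f by omega, Nat.factorial_succ] at e0
  rw [← e2, ← e0]
  have : (q : ℚ) + 1 + m ≠ 0 := by positivity
  push_cast
  field_simp
  ring

lemma main_aux (n f q e : ℕ) :
    E (n + 1) (2 * e + 1 + f) (q + 1) (e + 1) (1 - ((e + 1 : ℕ) : ℤ)) =
      macmahon (n + 1) (2 * e + 1 + f) (q + 1) *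
        (1 - (∑ m ∈ Finset.range (n + 1), (-1 : ℚ) ^ m * (n.choose m : ℚ) *
          ((q + 1 + f).factorial *
      ((((2 * e + 1 + f) + n - m).descFactorial (n + 2 * e + 1) : ℚ) / ((q : ℚ) + 1 + m)))) /
        kap (2 * e + 1 + f) q n) := by
  set b := 2 * e + 1 + f with hb
  have h1 := det_row b q n (Amat b q (n + 1) 0)
  have h2 := det_row b q n (fun j => Amat b q (n + 1) 0 j - Brow b q e (n + 1) j)
  rw [← E_reduce] at h2
  rw [Matrix.updateRow_eq_self, det_Amat b q (n + 1)] at h1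
  have h0 := sum_row_zero b q n
  rw [← Fin.sum_univ_eq_sum_range
      (fun m => ibinom ((b : ℤ) + q + 1) ((q : ℤ) + 1 + m) * yv b q n m)] at h0
  have hk : ∑ j : Fin (n + 1), (Amat b q (n + 1)) 0 j * yv b q n j = kap b q n := by
    rw [← h0]
    refine Finset.sum_congr rfl fun j _ => ?_
    simp [Amat]
  have hB : ∑ j : Fin (n + 1), Brow b q e (n + 1) j * yv b q n j =
      ∑ m ∈ Finset.range (n + 1), (-1 : ℚ) ^ m * (n.choose m : ℚ) *
          ((q + 1 + f).factorial *
      (((b + n - m).descFactorial (n + 2 * e + 1) : ℚ) / ((q : ℚ) + 1 + m))) := by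
    rw [← Fin.sum_univ_eq_sum_range (fun m => (-1 : ℚ) ^ m * (n.choose m : ℚ) *
          ((q + 1 + f).factorial *
      (((b + n - m).descFactorial (n + 2 * e + 1) : ℚ) / ((q : ℚ) + 1 + m))))]
    refine Finset.sum_congr rfl fun j _ => ?_
    rw [hb, ← brow_term f e q n j (by omega)]
    simp only [Brow, yv]
    ring
  rw [← hB]
  simp only [sub_mul, Finset.sum_sub_distrib] at h2
  rw [hk] at h1 h2
  set S := ∑ j : Fin (n + 1), Brow b q e (n + 1) j * yv b q n j
  have hkap : kap b q n ≠ 0 := by unfold kap; positivity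
  have hy : (((b + n).factorial : ℚ) * q.factorial) ≠ 0 := by positivity
  apply mul_right_cancel₀ hy
  rw [h2, show ∀ x y z : ℚ, x * y * z = (x * z) * y by intros; ring, h1]
  field_simp

/-- Formula for `E(a,b,c,d,1-d)` (Proposition: special case `p = 1 - d`). -/
theorem E_p_eq_one_sub_d (a b c d : ℕ) (ha : 0 < a) (hb : 0 < b) (hc : 0 < c) (hd : 0 < d)
    (h : 2 * d < b + 2) :
    E a b c d (1 - (d : ℤ)) =
      macmahon a b c *
        (1 - poch (c : ℚ) a /
            ((Nat.factorial (a - 1) : ℚ) * poch ((b : ℚ) + c - 2 * d + 2) (a + 2 * d - 2)) *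
          ∑ k ∈ Finset.range a,
            (-1 : ℚ) ^ (a + k - 1) * (Nat.choose (a - 1) k : ℚ) *
              poch ((b : ℚ) - 2 * d + k + 3 - a) (a + 2 * d - 2) / ((a : ℚ) + c - k - 1)) := by
  obtain ⟨n, rfl⟩ : ∃ n, a = n + 1 := ⟨a - 1, by omega⟩
  obtain ⟨q, rfl⟩ : ∃ q, c = q + 1 := ⟨c - 1, by omega⟩
  obtain ⟨e, rfl⟩ : ∃ e, d = e + 1 := ⟨d - 1, by omega⟩
  obtain ⟨f, rfl⟩ : ∃ f, b = 2 * e + 1 + f := ⟨b - (2 * e + 1), by omega⟩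
  rw [main_aux]
  congr 2
  have hpow : n + 1 + 2 * (e + 1) - 2 = n + 2 * e + 1 := by omega
  rw [hpow, Nat.add_sub_cancel]
  rw [poch_nat (q + n + 1) (n + 1) _ (by push_cast; ring),
    poch_nat (2 * e + 1 + f + q + 1 + n) (n + 2 * e + 1) _ (by push_cast; ring)]
  have e1 := Nat.factorial_mul_descFactorial
    (show n + 2 * e + 1 ≤ 2 * e + 1 + f + q + 1 + n by omega)
  rw [show 2 * e + 1 + f + q + 1 + n - (n + 2 * e + 1) = q + 1 + f by omega] at e1
  have e2 := Nat.factorial_mul_descFactorial (show n + 1 ≤ q + n + 1 by omega)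
  rw [show q + n + 1 - (n + 1) = q by omega] at e2
  have hsum : (∑ k ∈ Finset.range (n + 1),
      (-1 : ℚ) ^ (n + 1 + k - 1) * (Nat.choose n k : ℚ) *
        poch (((2 * e + 1 + f : ℕ) : ℚ) - 2 * ((e + 1 : ℕ) : ℚ) + k + 3 - ((n + 1 : ℕ) : ℚ))
          (n + 2 * e + 1) / (((n + 1 : ℕ) : ℚ) + ((q + 1 : ℕ) : ℚ) - k - 1)) =
      ∑ m ∈ Finset.range (n + 1), (-1 : ℚ) ^ m * (n.choose m : ℚ) *
      ((((2 * e + 1 + f) + n - m).descFactorial (n + 2 * e + 1) : ℚ) / ((q : ℚ) + 1 + m)) := by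
    rw [← Finset.sum_range_reflect]
    refine Finset.sum_congr rfl fun m hm => ?_
    have hm' : m ≤ n := by simpa [Nat.lt_succ_iff] using hm
    obtain ⟨l, rfl⟩ := Nat.exists_eq_add_of_le hm'
    rw [show m + l + 1 - 1 - m = l by omega, show m + l + 1 + l - 1 = m + 2 * l by omega]
    rw [poch_nat ((2 * e + 1 + f) + (m + l) - m) (m + l + 2 * e + 1) _ (by
      rw [show (2 * e + 1 + f) + (m + l) - m = 2 * e + 1 + f + l by omega]; push_cast; ring)]
    rw [Nat.choose_symm_add, pow_add, pow_mul]
    push_cast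
    rw [show (m : ℚ) + l + 1 + (q + 1) - l - 1 = q + 1 + m by ring]
    norm_num
    ring
  rw [hsum]
  have hS : (∑ m ∈ Finset.range (n + 1), (-1 : ℚ) ^ m * (n.choose m : ℚ) *
          ((q + 1 + f).factorial *
      ((((2 * e + 1 + f) + n - m).descFactorial (n + 2 * e + 1) : ℚ) / ((q : ℚ) + 1 + m)))) =
      ((q + 1 + f).factorial : ℚ) *
      ∑ m ∈ Finset.range (n + 1), (-1 : ℚ) ^ m * (n.choose m : ℚ) *
      ((((2 * e + 1 + f) + n - m).descFactorial (n + 2 * e + 1) : ℚ) / ((q : ℚ) + 1 + m)) := by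
    rw [Finset.mul_sum]
    exact Finset.sum_congr rfl fun m _ => by ring
  rw [hS]
  unfold kap
  rw [← e1, ← e2]
  have n1 : (((2 * e + 1 + f + q + 1 + n).descFactorial (n + 2 * e + 1) : ℕ) : ℚ) ≠ 0 := by
    intro h0
    have h0' : (2 * e + 1 + f + q + 1 + n).descFactorial (n + 2 * e + 1) = 0 := by exact_mod_cast h0
    rw [Nat.descFactorial_eq_zero_iff_lt] at h0'
    omega
  have n2 : (((q + n + 1).descFactorial (n + 1) : ℕ) : ℚ) ≠ 0 := by
    intro h0
    have h0' : (q + n + 1).descFactorial (n + 1) = 0 := by exact_mod_cast h0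
    rw [Nat.descFactorial_eq_zero_iff_lt] at h0'
    omega
  have n3 : ((q + 1 + f).factorial : ℚ) ≠ 0 := by positivity
  have n4 : (q.factorial : ℚ) ≠ 0 := by positivity
  have n5 : (n.factorial : ℚ) ≠ 0 := by positivity
  push_cast
  field_simp
end
end

section
/- Let a, b, c be nonnegative integers and d a positive integer with d ≤ ⌈b/2⌉. Then E(a,b,c,d,1−d) = M(a,b,c) · ( 1 − ((b−2d+2)_c / ((2d−2)! · (b+1)_{a+c−1})) · ∑_{k=1}^{a} (b+c+k)_{a−k} · (k)_{2d−2} · (c)_{k−1} ), where (x)_n denotes the Pochhammer symbol (rising factorial) and all quantities are evaluated over the rationals. -/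
open Finset

noncomputable section

/-- Partial fractions: an alternating sum of reciprocals. -/
lemma partial_frac (n : ℕ) : ∀ c : ℕ, 0 < c →
    ∑ s ∈ range (n + 1), (-1 : ℚ) ^ s * (n.choose s : ℚ) / ((c : ℚ) + s) =
      (n.factorial : ℚ) / (c.ascFactorial (n + 1) : ℚ) := by
  induction n with
  | zero =>
    intro c hc
    simp [Nat.ascFactorial]
  | succ n ih =>
    intro c hc
    have h1 := ih c hc
    have h2 := ih (c + 1) (by omega)
    have key : ∑ s ∈ range (n + 1 + 1), (-1 : ℚ) ^ s * ((n + 1).choose s : ℚ) / ((c : ℚ) + s) =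
        ∑ s ∈ range (n + 1), (-1 : ℚ) ^ s * (n.choose s : ℚ) / ((c : ℚ) + s) -
        ∑ s ∈ range (n + 1), (-1 : ℚ) ^ s * (n.choose s : ℚ) / (((c + 1 : ℕ) : ℚ) + s) := by
      rw [Finset.sum_range_succ']
      rw [← Finset.sum_sub_distrib] 
      have e : ∑ s ∈ range (n + 1), (-1 : ℚ) ^ s * (n.choose s : ℚ) / ((c : ℚ) + s) =
        ∑ s ∈ range (n + 1), (-1 : ℚ) ^ (s + 1) * (n.choose (s + 1) : ℚ) / ((c : ℚ) + (s + 1 : ℕ))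
          + 1 / (c : ℚ) := by
        have := Finset.sum_range_succ' (fun s : ℕ => (-1 : ℚ) ^ s * (n.choose s : ℚ) / ((c : ℚ) + s)) (n + 1)
        rw [Finset.sum_range_succ] at this
        simpa using this
      rw [Finset.sum_sub_distrib, e, add_sub_right_comm, ← Finset.sum_sub_distrib]
      congr 1
      · apply Finset.sum_congr rfl
        intro s _
        rw [Nat.choose_succ_succ]
        push_cast
        have : (c : ℚ) + 1 + s ≠ 0 := by positivity
        have : (c : ℚ) + (s + 1) ≠ 0 := by positivity
        field_simp
        ring
      · simp
    rw [key, h1, h2]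
    have e1 : c.ascFactorial (n + 1 + 1) = (c + (n + 1)) * c.ascFactorial (n + 1) := rfl
    have e2 := Nat.succ_ascFactorial c (n + 1)
    have p1 : (0 : ℚ) < (c.ascFactorial (n + 1) : ℚ) := by
      obtain ⟨c', rfl⟩ : ∃ c', c = c' + 1 := ⟨c - 1, by omega⟩
      exact_mod_cast Nat.ascFactorial_pos _ _
    have p2 : (0 : ℚ) < ((c + 1).ascFactorial (n + 1) : ℚ) := by
      exact_mod_cast Nat.ascFactorial_pos _ _
    have hc' : (0 : ℚ) < c := by exact_mod_cast hc
    have e3 : ((c + 1).ascFactorial (n + 1) : ℚ) = (c + (n + 1)) * c.ascFactorial (n + 1) / c := by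
      rw [eq_div_iff hc'.ne']
      have : ((c * (c + 1).ascFactorial (n + 1) : ℕ) : ℚ) = ((c + (n + 1)) * c.ascFactorial (n + 1) : ℕ) := by
        exact_mod_cast e2
      push_cast at this
      linarith
    rw [e1, e3, Nat.factorial_succ]
    push_cast
    field_simp
    ring

lemma newton_inner (N k c : ℕ) (hc : 0 < c) (hk : k ≤ N) :
    ∑ s ∈ range (N + 1), (-1 : ℚ) ^ s * (N.choose s : ℚ) / ((c : ℚ) + s) * (s.choose k : ℚ) =
      (N.factorial : ℚ) / (c.ascFactorial (N + 1) : ℚ) *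
        ((-1) ^ k * (c.ascFactorial k : ℚ) / (k.factorial : ℚ)) := by
  obtain ⟨n, rfl⟩ := Nat.exists_eq_add_of_le hk
  rw [show k + n + 1 = k + (n + 1) by ring, Finset.sum_range_add]
  rw [Finset.sum_eq_zero, zero_add]
  · have h := partial_frac n (c + k) (by omega)
    have : ∀ u ∈ range (n + 1), (-1 : ℚ) ^ (k + u) * ((k + n).choose (k + u) : ℚ) /
        ((c : ℚ) + (k + u : ℕ)) * ((k + u).choose k : ℚ) =
        (-1) ^ k * ((k + n).choose k : ℚ) * 
        ((-1 : ℚ) ^ u * (n.choose u : ℚ) / (((c + k : ℕ) : ℚ) + u)) := by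
      intro u hu
      have hu' : u ≤ n := by simpa [Nat.lt_succ_iff] using hu
      have := Nat.choose_mul (n := k + n) (k := k + u) (s := k) (by omega)
      rw [show k + n - k = n by omega, show k + u - k = u by omega] at this
      have : ((k + n).choose (k + u) : ℚ) * ((k + u).choose k : ℚ) =
         ((k + n).choose k : ℚ) * (n.choose u : ℚ) := by exact_mod_cast this
      rw [div_mul_eq_mul_div, mul_assoc, this]
      push_cast
      rw [pow_add, add_assoc]
      ring
    rw [Finset.sum_congr rfl this, ← Finset.mul_sum, h]
    have e := Nat.ascFactorial_mul_ascFactorial c k (n + 1)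
    rw [← e]
    have p1 : (0 : ℚ) < (c.ascFactorial k : ℚ) := by
      obtain ⟨c', rfl⟩ : ∃ c', c = c' + 1 := ⟨c - 1, by omega⟩
      exact_mod_cast Nat.ascFactorial_pos _ _
    have p2 : (0 : ℚ) < ((c + k).ascFactorial (n + 1) : ℚ) := by
      obtain ⟨c', rfl⟩ : ∃ c', c = c' + 1 := ⟨c - 1, by omega⟩
      rw [show c' + 1 + k = c' + k + 1 by ring]
      exact_mod_cast Nat.ascFactorial_pos _ _
    have e4 : ((k + n).choose k : ℚ) * k.factorial * n.factorial = (k + n).factorial := by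
      rw [Nat.choose_symm_add]
      exact_mod_cast Nat.add_choose_mul_factorial_mul_factorial k n
    rw [← e4]
    have := Nat.factorial_pos k
    push_cast
    field_simp
  · intro s hs
    rw [Nat.choose_eq_zero_of_lt (Finset.mem_range.mp hs)]
    simp

/-- Newton interpolation evaluated at `-c`. -/
lemma newton_sum (f : ℚ → ℚ) (N c : ℕ) (hc : 0 < c) :
    ∑ s ∈ range (N + 1), (-1 : ℚ) ^ s * (N.choose s : ℚ) / ((c : ℚ) + s) * f s =
      (N.factorial : ℚ) / (c.ascFactorial (N + 1) : ℚ) *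
        ∑ k ∈ range (N + 1), (-1) ^ k * (c.ascFactorial k : ℚ) / (k.factorial : ℚ) *
          ((fwdDiff (1 : ℚ))^[k] f 0) := by
  have hf : ∀ s ∈ range (N + 1), f (s : ℚ) =
      ∑ k ∈ range (N + 1), (s.choose k : ℚ) * ((fwdDiff (1 : ℚ))^[k] f 0) := by
    intro s hs
    have h := shift_eq_sum_fwdDiff_iter (1 : ℚ) f s 0
    simp only [zero_add, nsmul_eq_mul, mul_one] at h
    rw [h]
    apply Finset.sum_subset
    · intro x hx
      simp at *
      omega
    · intro x _ hx
      rw [Nat.choose_eq_zero_of_lt (by simpa using hx)]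
      simp
  rw [Finset.sum_congr rfl (fun s hs => by rw [hf s hs, Finset.mul_sum])]
  rw [Finset.sum_comm, Finset.mul_sum]
  apply Finset.sum_congr rfl
  intro k hk
  have := newton_inner N k c hc (by simpa [Nat.lt_succ_iff] using hk)
  rw [← mul_assoc, ← this, Finset.sum_mul]
  apply Finset.sum_congr rfl
  intro s _
  ring

lemma fwdDiff_desc (B : ℚ) (M k : ℕ) (hk : k ≤ M) (x : ℚ) :
    ((fwdDiff (1 : ℚ))^[k] (fun x => (descPochhammer ℚ M).eval (B - x))) x =
      (-1) ^ k * (M.descFactorial k : ℚ) * (descPochhammer ℚ (M - k)).eval (B - k - x) := by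
  induction k generalizing x with
  | zero => simp
  | succ k ih =>
    rw [Function.iterate_succ_apply', fwdDiff, ih (by omega), ih (by omega)]
    obtain ⟨n, rfl⟩ := Nat.exists_eq_add_of_le hk
    rw [show k + 1 + n - k = n + 1 by omega, show k + 1 + n - (k + 1) = n by omega,
      Nat.descFactorial_succ, show k + 1 + n - k = n + 1 by omega]
    set y := B - k - x with hy
    have h1 : (descPochhammer ℚ (n + 1)).eval y = y * (descPochhammer ℚ n).eval (y - 1) := by
      rw [descPochhammer_succ_left]; simp
    have h2 : (descPochhammer ℚ (n + 1)).eval (y - 1) = (y - 1 - n) * (descPochhammer ℚ n).eval (y - 1) := by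
      rw [descPochhammer_succ_right]; simp; ring
    rw [show B - k - (x + 1) = y - 1 by rw [hy]; ring, h1, h2,
      show B - ((k + 1 : ℕ) : ℚ) - x = y - 1 by rw [hy]; push_cast; ring]
    push_cast
    ring

/-- key evaluation -/
lemma key_eval (b N m c : ℕ) (hc : 0 < c) :
    ∑ s ∈ range (N + 1), (-1 : ℚ) ^ s * (N.choose s : ℚ) / ((c : ℚ) + s) *
        ((b + N - s).descFactorial (N + m) : ℚ) =
      (N.factorial : ℚ) / (c.ascFactorial (N + 1) : ℚ) *
        ∑ k ∈ range (N + 1), ((N + m).choose k : ℚ) * (c.ascFactorial k : ℚ) *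
          ((b + N - k).descFactorial (N + m - k) : ℚ) := by
  have h := newton_sum (fun x => (descPochhammer ℚ (N + m)).eval (((b + N : ℕ) : ℚ) - x)) N c hc
  have e : ∀ s ∈ range (N + 1), ∀ M : ℕ, (((b + N - s).descFactorial M : ℕ) : ℚ) =
      (descPochhammer ℚ M).eval (((b + N : ℕ) : ℚ) - s) := by
    intro s hs M
    have : s ≤ b + N := by simp at hs; omega
    rw [← descPochhammer_eval_eq_descFactorial, Nat.cast_sub this]
  rw [Finset.sum_congr rfl (fun s hs => by rw [e s hs])]
  rw [h]
  congr 1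
  apply Finset.sum_congr rfl
  intro k hk
  rw [e k hk, fwdDiff_desc _ _ _ (by simp at hk; omega), Nat.descFactorial_eq_factorial_mul_choose]
  have := Nat.factorial_pos k
  have h1 : ((-1 : ℚ) ^ k) * (-1) ^ k = 1 := by rw [← mul_pow]; simp
  push_cast
  rw [sub_zero]
  field_simp
  rw [sq, h1]
  ring

lemma asc_vandermonde (x y n : ℕ) :
    ∑ k ∈ range (n + 1), n.choose k * (x.ascFactorial k * y.ascFactorial (n - k)) =
      (x + y).ascFactorial n := by
  rw [← Finset.Nat.sum_antidiagonal_eq_sum_range_succ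
    (fun i j => n.choose i * (x.ascFactorial i * y.ascFactorial j))]
  induction n with
  | zero => simp
  | succ n ih =>
    have := Finset.sum_antidiagonal_choose_succ_mul (R := ℕ) (fun i j => x.ascFactorial i * y.ascFactorial j) n
    simp only [Nat.cast_id] at this
    rw [this, Nat.ascFactorial_succ, ← ih, Finset.mul_sum, ← Finset.sum_add_distrib]
    apply Finset.sum_congr rfl
    rintro ⟨i, j⟩ hij
    rw [Finset.HasAntidiagonal.mem_antidiagonal] at hij
    subst hij
    rw [Nat.choose_symm_add (a := i) (b := j)]
    simp only [Nat.ascFactorial_succ]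
    ring

lemma choose_conv (N k e : ℕ) (hk : k ≤ N) :
    ∑ t ∈ range (k + 1), (N - t).choose (k - t) * (t + e).choose t = (N + e + 1).choose k := by
  have h := asc_vandermonde (e + 1) (N - k + 1) k
  rw [show e + 1 + (N - k + 1) = (N - k + e + 1) + 1 by ring,
    Nat.ascFactorial_eq_factorial_mul_choose,
    show N - k + e + 1 + k = N + e + 1 by omega] at h
  apply Nat.eq_of_mul_eq_mul_left (Nat.factorial_pos k)
  rw [← h, Finset.mul_sum]
  apply Finset.sum_congr rfl
  intro t ht
  have ht' : t ≤ k := by simp at ht; omega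
  rw [Nat.ascFactorial_eq_factorial_mul_choose, Nat.ascFactorial_eq_factorial_mul_choose,
    show N - k + (k - t) = N - t by omega, ← Nat.choose_mul_factorial_mul_factorial ht',
    Nat.add_comm e t]
  ring

lemma double_sum (N b c e : ℕ) :
    ∑ k ∈ range (N + 1), (N + (e + 1)).choose k * c.ascFactorial k * (b + 1).ascFactorial (N - k) =
    ∑ t ∈ range (N + 1), (b + c + t + 1).ascFactorial (N - t) * (t + e).choose t * c.ascFactorial t := by
  have h : ∀ t ∈ range (N + 1), (b + c + t + 1).ascFactorial (N - t) * (t + e).choose t * c.ascFactorial t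
      = ∑ k ∈ range (N + 1), if t ≤ k then (N - t).choose (k - t) * (t + e).choose t *
        (c.ascFactorial k * (b + 1).ascFactorial (N - k)) else 0 := by
    intro t ht
    have ht' : t ≤ N := by simp at ht; omega
    obtain ⟨n, rfl⟩ := Nat.exists_eq_add_of_le ht'
    rw [show t + n + 1 = t + (n + 1) by ring, Finset.sum_range_add]
    rw [Finset.sum_eq_zero (fun x hx => if_neg (by simp at hx; omega)), zero_add]
    rw [show t + n - t = n by omega, show b + c + t + 1 = (c + t) + (b + 1) by ring, ← asc_vandermonde,
      Finset.sum_mul, Finset.sum_mul]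
    apply Finset.sum_congr rfl
    intro u hu
    rw [if_pos (by omega), show t + u - t = u by omega, ← Nat.ascFactorial_mul_ascFactorial c t u,
      show t + n - (t + u) = n - u by omega]
    ring
  rw [Finset.sum_congr rfl h, Finset.sum_comm]
  apply Finset.sum_congr rfl
  intro k hk
  have hk' : k ≤ N := by simp at hk; omega
  rw [← Finset.sum_filter]
  have : (range (N + 1)).filter (fun t => t ≤ k) = range (k + 1) := by
    ext; simp; omega
  rw [this, ← Finset.sum_mul, choose_conv N k e hk']
  ring_nf

lemma asc_vandermonde' (x y n : ℕ) :
    ∑ k ∈ range (n + 1), n.choose k * x.ascFactorial k * y.ascFactorial (n - k) =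
      (x + y).ascFactorial n := by
  rw [← asc_vandermonde]
  simp only [mul_assoc]

lemma ibinom_nat (n k : ℕ) : ibinom (n : ℤ) (k : ℤ) = (n.choose k : ℚ) := by
  unfold ibinom
  split_ifs with h
  · simp
  · rw [Nat.choose_eq_zero_of_lt (by omega)]
    simp

lemma ibinom_neg_s10 (n k : ℤ) (h : k < 0) : ibinom n k = 0 := by
  unfold ibinom
  rw [if_neg (by omega)]

lemma alt_sum_zero (P : Polynomial ℚ) (N : ℕ) (h : P.natDegree < N) :
    ∑ s ∈ range (N + 1), (-1 : ℚ) ^ s * (N.choose s : ℚ) * P.eval (s : ℚ) = 0 := by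
  have h1 := congrFun (Polynomial.fwdDiff_iter_eq_zero_of_degree_lt h) 0
  rw [fwdDiff_iter_eq_sum_shift] at h1
  simp only [zero_add, nsmul_eq_mul, mul_one, zsmul_eq_mul, Pi.zero_apply] at h1
  push_cast at h1
  have h2 : ∀ s ∈ range (N + 1), (-1 : ℚ) ^ s * (N.choose s : ℚ) * P.eval (s : ℚ) =
      (-1) ^ N * ((-1 : ℚ) ^ (N - s) * (N.choose s : ℚ) * P.eval (s : ℚ)) := by
    intro s hs
    have hs' : s ≤ N := by simp at hs; omega
    obtain ⟨n, rfl⟩ := Nat.exists_eq_add_of_le hs'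
    have : ((-1 : ℚ) ^ n) * (-1) ^ n = 1 := by rw [← mul_pow]; simp
    rw [show s + n - s = n by omega, pow_add]
    linear_combination (-(-1) ^ s * ((s + n).choose s : ℚ) * P.eval (s : ℚ)) * this
  rw [Finset.sum_congr rfl h2, ← Finset.mul_sum, h1, mul_zero]

/-- The first column of the inverse of the binomial matrix. -/
def xv (N b c s : ℕ) : ℚ :=
  (-1) ^ s * (N.choose s : ℚ) * ((c.ascFactorial s : ℚ) * ((b + N - s).factorial : ℚ)) *
    (((c + N).factorial : ℚ) / ((N.factorial : ℚ) * ((b + c + N).factorial : ℚ)))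

lemma xv_zero_c (N b s : ℕ) : xv N b 0 s = if s = 0 then 1 else 0 := by
  unfold xv
  cases s with
  | zero =>
    have := Nat.factorial_pos N
    have := Nat.factorial_pos (b + N)
    simp
    field_simp
  | succ s => simp [Nat.zero_ascFactorial]

lemma term_zero (N q m c s : ℕ) (hs : s ≤ N) :
    ((q + (c + 1)).choose (c + 1 + s) : ℚ) * (((c + 1).ascFactorial s : ℚ) * ((m + q + N - s).factorial : ℚ)) =
      ((q + (c + 1)).factorial : ℚ) / (c.factorial : ℚ) *
        (((m + q + N - s).descFactorial (N + m) : ℚ) / (((c + 1 : ℕ) : ℚ) + s)) := by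
  by_cases h : s ≤ q
  · obtain ⟨r, rfl⟩ := Nat.exists_eq_add_of_le h
    have h1 : ((s + r + (c + 1)).choose (c + 1 + s) : ℚ) * (c + 1 + s).factorial * r.factorial =
        (s + r + (c + 1)).factorial := by
      have := Nat.choose_mul_factorial_mul_factorial (n := s + r + (c + 1)) (k := c + 1 + s) (by omega)
      rw [show s + r + (c + 1) - (c + 1 + s) = r by omega] at this
      exact_mod_cast this
    have h2 : (c.factorial : ℚ) * ((c + 1).ascFactorial s : ℚ) = (c + s).factorial := by
      exact_mod_cast Nat.factorial_mul_ascFactorial c s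
    have h3 : (r.factorial : ℚ) * ((m + (s + r) + N - s).descFactorial (N + m) : ℚ) =
        (m + (s + r) + N - s).factorial := by
      have := Nat.factorial_mul_descFactorial (n := m + (s + r) + N - s) (k := N + m) (by omega)
      rw [show m + (s + r) + N - s - (N + m) = r by omega] at this
      exact_mod_cast this
    rw [← h3, ← h1, show c + 1 + s = (c + s) + 1 by ring, Nat.factorial_succ]
    have := Nat.factorial_pos c
    have e1 : ((c + 1).ascFactorial s : ℚ) = (c + s).factorial / c.factorial := by
      rw [eq_div_iff (by positivity)]; linarith
    rw [e1]
    push_cast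
    field_simp
    ring
  · rw [Nat.choose_eq_zero_of_lt (by omega), Nat.descFactorial_of_lt (by omega)]
    simp

lemma term_pos (N b c s I n : ℕ) (hN : N = I + 1 + n) (hs : s ≤ N) :
    ibinom ((b : ℤ) + ((c + 1 : ℕ) : ℤ)) (((c + 1 : ℕ) : ℤ) - ((I + 1 : ℕ) : ℤ) + (s : ℤ)) *
        (((c + 1).ascFactorial s : ℚ) * ((b + N - s).factorial : ℚ)) =
      ((b + (c + 1)).factorial : ℚ) / (c.factorial : ℚ) *
        (((c + s).descFactorial I : ℚ) * ((b + N - s).descFactorial n : ℚ)) := by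
  by_cases h : I ≤ c + s
  · obtain ⟨u, hu⟩ := Nat.exists_eq_add_of_le h
    rw [show ((c + 1 : ℕ) : ℤ) - ((I + 1 : ℕ) : ℤ) + (s : ℤ) = (u : ℤ) by push_cast; omega,
      show (b : ℤ) + ((c + 1 : ℕ) : ℤ) = ((b + (c + 1) : ℕ) : ℤ) by push_cast; ring, ibinom_nat]
    by_cases h' : s ≤ b + I + 1
    · obtain ⟨v, hv⟩ := Nat.exists_eq_add_of_le h'
      have h1 : ((b + (c + 1)).choose u : ℚ) * u.factorial * v.factorial =
          (b + (c + 1)).factorial := by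
        have := Nat.choose_mul_factorial_mul_factorial (n := b + (c + 1)) (k := u) (by omega)
        rw [show b + (c + 1) - u = v by omega] at this
        exact_mod_cast this
      have h2 : (c.factorial : ℚ) * ((c + 1).ascFactorial s : ℚ) = (c + s).factorial := by
        exact_mod_cast Nat.factorial_mul_ascFactorial c s
      have h3 : (v.factorial : ℚ) * ((b + N - s).descFactorial n : ℚ) =
          (b + N - s).factorial := by
        have := Nat.factorial_mul_descFactorial (n := b + N - s) (k := n) (by omega)
        rw [show b + N - s - n = v by omega] at this
        exact_mod_cast this
      have h4 : (u.factorial : ℚ) * ((c + s).descFactorial I : ℚ) = (c + s).factorial := by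
        have := Nat.factorial_mul_descFactorial (n := c + s) (k := I) (by omega)
        rw [show c + s - I = u by omega] at this
        exact_mod_cast this
      have := Nat.factorial_pos c
      have e1 : ((c + 1).ascFactorial s : ℚ) = (c + s).factorial / c.factorial := by
        rw [eq_div_iff (by positivity)]; linarith
      rw [e1, ← h3, ← h4, ← h1]
      field_simp
    · rw [Nat.choose_eq_zero_of_lt (by omega), Nat.descFactorial_of_lt (n := b + N - s) (by omega)]
      simp
  · rw [ibinom_neg_s10 _ _ (by push_cast; omega), Nat.descFactorial_of_lt (n := c + s) (by omega)]
    simp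

/-- Evaluation of the pairing of a binomial row with `xv`. -/
lemma pair_eval (N q m c : ℕ) :
    ∑ s ∈ range (N + 1), ((q + (c + 1)).choose (c + 1 + s) : ℚ) * xv N (m + q) (c + 1) s =
      ((q + (c + 1)).factorial : ℚ) / (((m + q + (c + 1) + N).factorial : ℚ) * (q.factorial : ℚ)) *
      ((m + q).factorial * ((∑ k ∈ range (N + 1), (N + m).choose k * (c + 1).ascFactorial k *
        (m + q + 1).ascFactorial (N - k) : ℕ) : ℚ)) := by
  have hk := key_eval (m + q) N m (c + 1) (by omega)
  have h1 : ∀ s ∈ range (N + 1), ((q + (c + 1)).choose (c + 1 + s) : ℚ) * xv N (m + q) (c + 1) s =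
      (((q + (c + 1)).factorial : ℚ) / (c.factorial : ℚ) * (((c + 1 + N).factorial : ℚ) / ((N.factorial : ℚ) * ((m + q + (c + 1) + N).factorial : ℚ)))) *
      ((-1 : ℚ) ^ s * (N.choose s : ℚ) / (((c + 1 : ℕ) : ℚ) + s) *
        ((m + q + N - s).descFactorial (N + m) : ℚ)) := by
    intro s hs
    have := term_zero N q m c s (by simp at hs; omega)
    unfold xv
    linear_combination ((-1 : ℚ) ^ s * (N.choose s : ℚ) * (((c + 1 + N).factorial : ℚ) / ((N.factorial : ℚ) * ((m + q + (c + 1) + N).factorial : ℚ)))) * this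
  rw [Finset.sum_congr rfl h1, ← Finset.mul_sum, hk]
  have h2 : (c.factorial : ℚ) * ((c + 1).ascFactorial (N + 1) : ℚ) = (c + 1 + N).factorial := by
    rw [show c + 1 + N = c + (N + 1) by ring]
    exact_mod_cast Nat.factorial_mul_ascFactorial c (N + 1)
  have h3 : ∀ k ∈ range (N + 1), ((N + m).choose k : ℚ) * ((c + 1).ascFactorial k : ℚ) *
          ((m + q + N - k).descFactorial (N + m - k) : ℚ) = 
          ((m + q).factorial : ℚ) / (q.factorial : ℚ) * (((N + m).choose k * (c + 1).ascFactorial k *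
        (m + q + 1).ascFactorial (N - k) : ℕ) : ℚ) := by
    intro k hk
    have hk' : k ≤ N := by simp at hk; omega
    have e1 : ((m + q).factorial : ℚ) * ((m + q + 1).ascFactorial (N - k) : ℚ) = (m + q + N - k).factorial := by
      rw [show m + q + N - k = m + q + (N - k) by omega]
      exact_mod_cast Nat.factorial_mul_ascFactorial (m + q) (N - k)
    have e2 : (q.factorial : ℚ) * ((m + q + N - k).descFactorial (N + m - k) : ℚ) = (m + q + N - k).factorial := by
      have := Nat.factorial_mul_descFactorial (n := m + q + N - k) (k := N + m - k) (by omega)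
      rw [show m + q + N - k - (N + m - k) = q by omega] at this
      exact_mod_cast this
    have := Nat.factorial_pos q
    push_cast
    field_simp
    linear_combination ((N + m).choose k : ℚ) * (e2 - e1)
  rw [Finset.sum_congr rfl h3, ← Finset.mul_sum, ← h2]
  have := Nat.factorial_pos c
  have := Nat.factorial_pos N
  have := Nat.factorial_pos q
  have := Nat.factorial_pos (m + q + (c + 1) + N)
  have := Nat.ascFactorial_pos c (N + 1)
  push_cast
  field_simp

lemma xv_row (N b c I : ℕ) (hI : I ≤ N) :
    ∑ s ∈ range (N + 1), ibinom ((b : ℤ) + (c : ℤ)) ((c : ℤ) - (I : ℤ) + (s : ℤ)) * xv N b c s =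
      if I = 0 then 1 else 0 := by
  rcases Nat.eq_zero_or_pos c with rfl | hc
  · simp only [xv_zero_c]
    simp
    split_ifs with h
    · subst h
      simpa using ibinom_nat b 0
    · exact ibinom_neg_s10 _ _ (by omega)
  obtain ⟨c, rfl⟩ : ∃ c', c = c' + 1 := ⟨c - 1, by omega⟩
  rcases Nat.eq_zero_or_pos I with rfl | hI0
  · have h := pair_eval N b 0 c
    simp only [Nat.add_zero, Nat.zero_add] at h
    rw [asc_vandermonde' ] at h
    rw [if_pos rfl]
    have e : ∀ s : ℕ, ibinom ((b : ℤ) + ((c + 1 : ℕ) : ℤ)) (((c + 1 : ℕ) : ℤ) - ((0 : ℕ) : ℤ) + (s : ℤ)) =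
        ((b + (c + 1)).choose (c + 1 + s) : ℚ) := by
      intro s
      rw [← ibinom_nat]
      push_cast
      simp
    simp only [e]
    rw [h]
    have h2 : ((b + (c + 1)).factorial : ℚ) * ((c + 1 + (b + 1)).ascFactorial N : ℚ) = (b + (c + 1) + N).factorial := by
      rw [show c + 1 + (b + 1) = b + (c + 1) + 1 by ring]
      exact_mod_cast Nat.factorial_mul_ascFactorial (b + (c + 1)) N
    rw [← h2]
    have := Nat.factorial_pos b
    have := Nat.factorial_pos (b + (c + 1))
    have := Nat.ascFactorial_pos (c + 1 + b) N
    rw [show c + 1 + (b + 1) = c + 1 + b + 1 by ring]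
    field_simp
  · obtain ⟨I, rfl⟩ : ∃ c', I = c' + 1 := ⟨I - 1, by omega⟩
    obtain ⟨n, hn⟩ := Nat.exists_eq_add_of_le hI
    rw [if_neg (by omega)]
    let P : Polynomial ℚ := (descPochhammer ℚ I).comp (Polynomial.X + Polynomial.C (c : ℚ)) *
      (descPochhammer ℚ n).comp (Polynomial.C ((b + N : ℕ) : ℚ) - Polynomial.X)
    have hP : P.natDegree < N := by
      have h1 : P.natDegree ≤ I * 1 + n * 1 := by
        refine Polynomial.natDegree_mul_le.trans (add_le_add ?_ ?_)
        · refine Polynomial.natDegree_comp_le.trans (Nat.mul_le_mul ?_ ?_)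
          · rw [descPochhammer_natDegree]
          · rw [Polynomial.natDegree_X_add_C]
        · refine Polynomial.natDegree_comp_le.trans (Nat.mul_le_mul ?_ ?_)
          · rw [descPochhammer_natDegree]
          · refine (Polynomial.natDegree_sub_le _ _).trans ?_
            rw [Polynomial.natDegree_C, Polynomial.natDegree_X]
            simp
      omega
    have h0 := alt_sum_zero P N hP
    have e : ∀ s ∈ range (N + 1), ibinom ((b : ℤ) + ((c + 1 : ℕ) : ℤ)) (((c + 1 : ℕ) : ℤ) - ((I + 1 : ℕ) : ℤ) + (s : ℤ)) * xv N b (c + 1) s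
       = (((b + (c + 1)).factorial : ℚ) / (c.factorial : ℚ) * (((c + 1 + N).factorial : ℚ) / ((N.factorial : ℚ) * ((b + (c + 1) + N).factorial : ℚ)))) * ((-1 : ℚ) ^ s * (N.choose s : ℚ) * P.eval (s : ℚ)) := by
      intro s hs
      have hs' : s ≤ N := by simp at hs; omega
      have h1 := term_pos N b c s I n hn hs'
      have h2 : P.eval (s : ℚ) = ((c + s).descFactorial I : ℚ) * ((b + N - s).descFactorial n : ℚ) := by
        rw [← descPochhammer_eval_eq_descFactorial, ← descPochhammer_eval_eq_descFactorial, Nat.cast_sub (by omega)]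
        simp [P, add_comm]
      rw [h2]
      unfold xv
      linear_combination ((-1 : ℚ) ^ s * (N.choose s : ℚ) * (((c + 1 + N).factorial : ℚ) / ((N.factorial : ℚ) * ((b + (c + 1) + N).factorial : ℚ)))) * h1
    rw [Finset.sum_congr rfl e, ← Finset.mul_sum, h0, mul_zero]

/-- The lateral binomial matrix. -/
def BM (a b c : ℕ) : Matrix (Fin a) (Fin a) ℚ :=
  Matrix.of fun i j => ibinom ((b : ℤ) + (c : ℤ)) ((c : ℤ) - ((i : ℕ) : ℤ) + ((j : ℕ) : ℤ))

lemma BM_mulVec (N b c : ℕ) :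
    (BM (N + 1) b c).mulVec (fun j => xv N b c j) = Pi.single 0 1 := by
  ext i
  have h := xv_row N b c i (by omega)
  rw [Finset.sum_range] at h
  simp only [Matrix.mulVec, dotProduct, BM, Matrix.of_apply]
  rw [h, Pi.single_apply]
  by_cases hi : i = 0
  · subst hi
    simp
  · rw [if_neg hi, if_neg (fun h0 : (i : ℕ) = 0 => hi (Fin.ext h0))]

lemma adj_col {n : ℕ} (A : Matrix (Fin (n + 1)) (Fin (n + 1)) ℚ) (x : Fin (n + 1) → ℚ)
    (h : A.mulVec x = Pi.single 0 1) (j : Fin (n + 1)) : A.adjugate j 0 = A.det * x j := by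
  have h1 : A.adjugate.mulVec (A.mulVec x) = A.det • x := by
    rw [Matrix.mulVec_mulVec, Matrix.adjugate_mul, Matrix.smul_mulVec, Matrix.one_mulVec]
  rw [h, Matrix.mulVec_single_one] at h1
  have h2 := congrFun h1 j
  rw [Pi.smul_apply, smul_eq_mul] at h2
  exact h2

lemma det_updateRow_pair {n : ℕ} (A : Matrix (Fin (n + 1)) (Fin (n + 1)) ℚ) (x r : Fin (n + 1) → ℚ)
    (h : A.mulVec x = Pi.single 0 1) : (A.updateRow 0 r).det = A.det * ∑ j, r j * x j := by
  rw [← Matrix.cramer_transpose_apply, Matrix.cramer_eq_adjugate_mulVec, ← Matrix.adjugate_transpose,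
    Matrix.mulVec, dotProduct, Finset.mul_sum]
  apply Finset.sum_congr rfl
  intro j _
  rw [Matrix.transpose_apply, adj_col A x h]
  ring

lemma det_BM (a b c : ℕ) : (BM a b c).det = macmahon a b c := by
  induction a with
  | zero => simp [macmahon]
  | succ N ih =>
    have h := adj_col (BM (N + 1) b c) _ (BM_mulVec N b c) 0
    rw [Matrix.adjugate_fin_succ_eq_det_submatrix] at h
    have e : (BM (N + 1) b c).submatrix (Fin.succAbove 0) (Fin.succAbove 0) = BM N b c := by
      ext i j
      simp only [BM, Matrix.submatrix_apply, Matrix.of_apply, Fin.succAbove_zero, Fin.val_succ]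
      congr 1
      push_cast
      ring
    rw [e, ih] at h
    have h2 : macmahon (N + 1) b c = macmahon N b c * (((Nat.factorial N : ℚ) * (Nat.factorial (b + c + N) : ℚ)) /
      ((Nat.factorial (b + N) : ℚ) * (Nat.factorial (c + N) : ℚ))) := by
      unfold macmahon
      rw [Finset.prod_range_succ]
    rw [h2]
    simp [xv] at h
    rw [h]
    have := Nat.factorial_pos N
    have := Nat.factorial_pos (b + N)
    have := Nat.factorial_pos (c + N)
    have := Nat.factorial_pos (b + c + N)
    field_simp

lemma E_reduce_s10 (N b c e : ℕ) :
    E (N + 1) b c (e + 1) (1 - ((e + 1 : ℕ) : ℤ)) =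
      macmahon (N + 1) b c * (1 - ∑ s ∈ range (N + 1),
        ibinom ((b : ℤ) + c - (2 * e + 1 : ℕ)) ((c : ℤ) + s) * xv N b c s) := by
  set p : ℤ := 1 - ((e + 1 : ℕ) : ℤ) with hp
  let B : Matrix (Fin (N + 1)) (Fin (e + 1)) ℚ := Matrix.of fun i j => if i = 0 ∧ j = Fin.last e then 1 else 0
  let C : Matrix (Fin (e + 1)) (Fin (N + 1)) ℚ := Matrix.of fun i j =>
    ibinom ((b : ℤ) + c - 2 * (((i : ℕ) : ℤ) + 1) + 1)
          ((c : ℤ) - (((i : ℕ) : ℤ) + 1) + (((j : ℕ) : ℤ) + 1) - p)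
  let D : Matrix (Fin (e + 1)) (Fin (e + 1)) ℚ := Matrix.of fun i j =>
    ibinom (2 * (((j : ℕ) : ℤ) - ((i : ℕ) : ℤ))) (((j : ℕ) : ℤ) - ((i : ℕ) : ℤ))
  have hQ : (Qmat (N + 1) b c (e + 1) p).submatrix finSumFinEquiv finSumFinEquiv =
      Matrix.fromBlocks (BM (N + 1) b c) B C D := by
    ext i j
    rcases i with i | i <;> rcases j with j | j
    · simp only [Qmat, BM, Matrix.submatrix_apply, Matrix.of_apply, finSumFinEquiv_apply_left,
        Matrix.fromBlocks_apply₁₁, Fin.val_castAdd, i.isLt, j.isLt, if_true]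
      congr 1
      ring
    · simp only [Qmat, B, Matrix.submatrix_apply, Matrix.of_apply, finSumFinEquiv_apply_left,
        finSumFinEquiv_apply_right, Matrix.fromBlocks_apply₁₂, Fin.val_castAdd, Fin.val_natAdd, i.isLt, if_true]
      rw [if_neg (by omega)]
      split_ifs with h
      · obtain ⟨rfl, rfl⟩ := h
        unfold ibinom
        rw [if_pos (by simp [hp]; omega)]
        have : (((N + 1 + e : ℕ) : ℤ) - ((N + 1 : ℕ) : ℤ) + 1 - ((((0 : Fin (N + 1)) : ℕ) : ℤ) + 1) + p).toNat = 0 := by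
          rw [hp]; simp
        simp only [Fin.val_last]
        rw [this]
        simp
      · apply ibinom_neg_s10
        rw [hp]
        have : ¬ ((i : ℕ) = 0 ∧ (j : ℕ) = e) := by
          rintro ⟨h1, h2⟩
          exact h ⟨Fin.ext h1, Fin.ext h2⟩
        push_cast
        omega
    · simp only [Qmat, C, Matrix.submatrix_apply, Matrix.of_apply, finSumFinEquiv_apply_left,
        finSumFinEquiv_apply_right, Matrix.fromBlocks_apply₂₁, Fin.val_castAdd, Fin.val_natAdd, j.isLt, if_true]
      rw [if_neg (by omega)]
      congr 1 <;> push_cast <;> ring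
    · simp only [Qmat, D, Matrix.submatrix_apply, Matrix.of_apply, 
        finSumFinEquiv_apply_right, Matrix.fromBlocks_apply₂₂, Fin.val_natAdd]
      rw [if_neg (by omega), if_neg (by omega)]
      congr 1 <;> push_cast <;> ring
  have hDlow : ∀ i j : Fin (e + 1), j < i → D i j = 0 := by
    intro i j hij
    apply ibinom_neg_s10
    have : (j : ℕ) < i := hij
    omega
  have hDdiag : ∀ i, D i i = 1 := by
    intro i
    simp [D, ibinom]
  have hD : D.det = 1 := by
    rw [Matrix.det_of_upperTriangular (fun i j hij => hDlow i j hij)]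
    simp [hDdiag]
  have hBD : B * D = B := by
    ext i j
    rw [Matrix.mul_apply, Finset.sum_eq_single (Fin.last e)]
    · by_cases hj : j = Fin.last e
      · subst hj
        rw [hDdiag, mul_one]
      · rw [hDlow _ _ (lt_of_le_of_ne (Fin.le_last j) hj)]
        simp [B, hj]
    · intro k _ hk
      simp [B, hk]
    · simp
  have : Invertible D := Matrix.invertibleOfIsUnitDet D (by rw [hD]; exact isUnit_one)
  have hB : B * ⅟D = B := by
    conv_lhs => rw [← hBD]
    rw [Matrix.mul_assoc, mul_invOf_self, Matrix.mul_one]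
  let r : Fin (N + 1) → ℚ := fun j => ibinom ((b : ℤ) + c - (2 * e + 1 : ℕ)) ((c : ℤ) + ((j : ℕ) : ℤ))
  have hS : BM (N + 1) b c - B * C = (BM (N + 1) b c).updateRow 0 (BM (N + 1) b c 0 + (-1 : ℚ) • r) := by
    ext i j
    rw [Matrix.sub_apply, Matrix.mul_apply, Finset.sum_eq_single (Fin.last e)]
    · by_cases hi : i = 0
      · subst hi
        rw [Matrix.updateRow_self]
        have : C (Fin.last e) j = r j := by
          simp only [C, r, Matrix.of_apply, Fin.val_last, hp]
          congr 1 <;> push_cast <;> ring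
        rw [this]
        simp [B]
        ring
      · rw [Matrix.updateRow_ne hi]
        simp [B, hi]
    · intro k _ hk
      simp [B, hk]
    · simp
  unfold E
  rw [← Matrix.det_submatrix_equiv_self finSumFinEquiv, hQ, Matrix.det_fromBlocks₂₂, hD, hB, one_mul, hS,
    Matrix.det_updateRow_add, Matrix.det_updateRow_smul, Matrix.updateRow_eq_self,
    det_updateRow_pair _ _ r (BM_mulVec N b c), det_BM, Finset.sum_range]
  ring

lemma poch_nat_s10 (n k : ℕ) : poch (n : ℚ) k = (n.ascFactorial k : ℚ) := by
  unfold poch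
  rw [ascPochhammer_nat_eq_natCast_ascFactorial]

/-- Proposition: formula for `E(a,b,c,d,1-d)` for `d ≤ ⌈b/2⌉`. -/
theorem E_p_eq_one_sub_d_formula (a b c d : ℕ) (hd : 0 < d) (hdb : d ≤ (b + 1) / 2) :
    E a b c d (1 - (d : ℤ)) =
      macmahon a b c *
        (1 - poch ((b : ℚ) - 2 * d + 2) c /
            ((Nat.factorial (2 * d - 2) : ℚ) * poch ((b : ℚ) + 1) (a + c - 1)) *
          ∑ k ∈ Finset.Icc 1 a,
            poch ((b : ℚ) + c + k) (a - k) * poch (k : ℚ) (2 * d - 2) *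
              poch (c : ℚ) (k - 1)) := by
  obtain ⟨e, rfl⟩ : ∃ e, d = e + 1 := ⟨d - 1, by omega⟩
  obtain ⟨q, rfl⟩ : ∃ q, b = 2 * e + 1 + q := ⟨b - (2 * e + 1), by omega⟩
  rcases Nat.eq_zero_or_pos a with rfl | ha
  · simp only [E, macmahon]
    rw [Matrix.det_of_upperTriangular]
    · simp [Qmat, ibinom]
    · intro i j hij
      have : (j : ℕ) < i := hij
      simp only [Qmat, Matrix.of_apply]
      rw [if_neg (by omega), if_neg (by omega)]
      apply ibinom_neg_s10
      omega
  obtain ⟨N, rfl⟩ : ∃ N, a = N + 1 := ⟨a - 1, by omega⟩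
  rw [E_reduce_s10]
  congr 2
  have hsum : ∑ k ∈ Finset.Icc 1 (N + 1),
            poch (((2 * e + 1 + q : ℕ) : ℚ) + c + k) (N + 1 - k) * poch (k : ℚ) (2 * (e + 1) - 2) *
              poch (c : ℚ) (k - 1) = 
      ((2 * e).factorial : ℚ) * ((∑ t ∈ range (N + 1), (2 * e + 1 + q + c + t + 1).ascFactorial (N - t) *
        (t + 2 * e).choose t * c.ascFactorial t : ℕ) : ℚ) := by
    have hI : Finset.Icc 1 (N + 1) = (range (N + 1)).image (fun t => t + 1) := by
      ext k
      simp only [Finset.mem_Icc, Finset.mem_image, Finset.mem_range]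
      constructor
      · intro h
        exact ⟨k - 1, by omega, by omega⟩
      · rintro ⟨t, h, rfl⟩
        omega
    rw [hI, Finset.sum_image (fun x _ y _ h => by simpa using h), Nat.cast_sum, Finset.mul_sum]
    apply Finset.sum_congr rfl
    intro t _
    have p1 : poch (((2 * e + 1 + q : ℕ) : ℚ) + c + ((t + 1 : ℕ) : ℚ)) (N + 1 - (t + 1)) =
        ((2 * e + 1 + q + c + t + 1).ascFactorial (N - t) : ℚ) := by
      rw [← poch_nat_s10, show N + 1 - (t + 1) = N - t by omega]
      congr 1
      push_cast
      ring
    have p2 : poch ((t + 1 : ℕ) : ℚ) (2 * (e + 1) - 2) =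
        ((2 * e).factorial : ℚ) * ((t + 2 * e).choose t : ℚ) := by
      rw [poch_nat_s10, show 2 * (e + 1) - 2 = 2 * e by omega,
        Nat.ascFactorial_eq_factorial_mul_choose, Nat.choose_symm_add]
      push_cast
      ring
    rw [p1, p2, show t + 1 - 1 = t by omega, poch_nat_s10]
    push_cast
    ring
  have h1 : poch (((2 * e + 1 + q : ℕ) : ℚ) - 2 * ((e + 1 : ℕ) : ℚ) + 2) c = ((q + 1).ascFactorial c : ℚ) := by
    rw [← poch_nat_s10]
    congr 1
    push_cast
    ring
  have h2 : poch (((2 * e + 1 + q : ℕ) : ℚ) + 1) (N + 1 + c - 1) = ((2 * e + 1 + q + 1).ascFactorial (N + c) : ℚ) := by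
    rw [← poch_nat_s10]
    rw [show N + 1 + c - 1 = N + c by omega]
    push_cast
    rfl
  rw [hsum, h1, h2, show 2 * (e + 1) - 2 = 2 * e by omega]
  have e1 : ∀ s : ℕ, ibinom (((2 * e + 1 + q : ℕ) : ℤ) + c - ((2 * e + 1 : ℕ) : ℤ)) ((c : ℤ) + s) =
      ((q + c).choose (c + s) : ℚ) := by
    intro s
    rw [← ibinom_nat]
    congr 1
    push_cast
    ring
  simp only [e1]
  have g1 : ((2 * e + 1 + q).factorial : ℚ) * ((2 * e + 1 + q + 1).ascFactorial (N + c) : ℚ) =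
      (2 * e + 1 + q + c + N).factorial := by
    rw [show 2 * e + 1 + q + c + N = 2 * e + 1 + q + (N + c) by ring]
    exact_mod_cast Nat.factorial_mul_ascFactorial (2 * e + 1 + q) (N + c)
  have g2 : (q.factorial : ℚ) * ((q + 1).ascFactorial c : ℚ) = (q + c).factorial := by
    exact_mod_cast Nat.factorial_mul_ascFactorial q c
  have := Nat.factorial_pos (2 * e)
  have := Nat.factorial_pos q
  have := Nat.factorial_pos (2 * e + 1 + q)
  have := Nat.ascFactorial_pos (2 * e + 1 + q) (N + c)
  rcases Nat.eq_zero_or_pos c with rfl | hc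
  · simp only [xv_zero_c]
    have z : ∑ t ∈ range (N + 1), (2 * e + 1 + q + 0 + t + 1).ascFactorial (N - t) *
        (t + 2 * e).choose t * (0 : ℕ).ascFactorial t = (2 * e + 1 + q + 1).ascFactorial (N + 0) := by
      rw [Finset.sum_range_succ', Finset.sum_eq_zero]
      · simp
      · intro t _
        rw [Nat.zero_ascFactorial, mul_zero]
    rw [z]
    simp
    field_simp
  · obtain ⟨c, rfl⟩ : ∃ c', c = c' + 1 := ⟨c - 1, by omega⟩
    rw [pair_eval, double_sum, ← g1, ← g2]
    field_simp
end
end
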